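/- Let R be an indecomposable non-local ring (the only central idempotents of R are 0 and 1, and R is not a local ring). Then R is a right q-ring if and only if R is a right CS ring and a right a-ring. -/

import Mathlib

/-- A module `M` over a ring `A` is *automorphism-invariant* if every injective
`A`-linear map from a submodule of `M` into `M` extends to an endomorphism of `M`. -/
def IsAutomorphismInvariant (A : Type*) [Ring A] (M : Type*) [AddCommGroup M]
    [Module A M] : Prop :=
  ∀ (N : Submodule A M) (f : N →ₗ[A] M), Function.Injective f →
    ∃ g : M →ₗ[A] M, ∀ n : N, g n = f n

/-- A module `M` over a ring `A` is *quasi-injective* if every `A`-linear map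
from a submodule of `M` into `M` extends to an endomorphism of `M`. -/
def IsQuasiInjective (A : Type*) [Ring A] (M : Type*) [AddCommGroup M]
    [Module A M] : Prop :=
  ∀ (N : Submodule A M) (f : N →ₗ[A] M), ∃ g : M →ₗ[A] M, ∀ n : N, g n = f n

/-- Right ideals of `R` are the `Rᵐᵒᵖ`-submodules of `R`.  A ring `R` is a *right
`a`-ring* if every right ideal of `R` is automorphism-invariant as a right `R`-module
(i.e. as an `Rᵐᵒᵖ`-module). -/
def IsRightARing (R : Type*) [Ring R] : Prop :=
  ∀ I : Submodule Rᵐᵒᵖ R, IsAutomorphismInvariant Rᵐᵒᵖ I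

/-- A ring `R` is a *right `q`-ring* if every right ideal of `R` is quasi-injective
as a right `R`-module. -/
def IsRightQRing (R : Type*) [Ring R] : Prop :=
  ∀ I : Submodule Rᵐᵒᵖ R, IsQuasiInjective Rᵐᵒᵖ I

/-- A right ideal is *essential* if it intersects every nonzero right ideal
nontrivially. -/
def IsEssentialRightIdeal (R : Type*) [Ring R] (I : Submodule Rᵐᵒᵖ R) : Prop :=
  ∀ J : Submodule Rᵐᵒᵖ R, I ⊓ J = ⊥ → J = ⊥

/-- The right ideal `eR` generated by an element `e`. -/
def rightIdealOf (R : Type*) [Ring R] (e : R) : Submodule Rᵐᵒᵖ R where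
  carrier := {x : R | ∃ r : R, x = e * r}
  zero_mem' := ⟨0, by simp⟩
  add_mem' := by rintro x y ⟨r, rfl⟩ ⟨s, rfl⟩; exact ⟨r + s, by rw [mul_add]⟩
  smul_mem' := by
    rintro c x ⟨r, rfl⟩
    exact ⟨r * c.unop, by rw [MulOpposite.smul_eq_mul_unop, mul_assoc]⟩

/-- The right annihilator of an element `a` of `R`, as a right ideal. -/
def rightAnnihilator (R : Type*) [Ring R] (a : R) : Submodule Rᵐᵒᵖ R where
  carrier := {r : R | a * r = 0}
  zero_mem' := by simp
  add_mem' := by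
    intro x y hx hy
    simp only [Set.mem_setOf_eq] at *
    rw [mul_add, hx, hy, add_zero]
  smul_mem' := by
    intro c x hx
    simp only [Set.mem_setOf_eq] at *
    rw [MulOpposite.smul_eq_mul_unop, ← mul_assoc, hx, zero_mul]

/-- The socle of a module: the sum of all its simple submodules. -/
def moduleSocle (A : Type*) [Ring A] (M : Type*) [AddCommGroup M] [Module A M] :
    Submodule A M :=
  sSup {N : Submodule A M | IsSimpleModule A N}

/-- A module is *square-free* if it contains no pair of nonzero independent
isomorphic submodules (equivalently, no nonzero submodule isomorphic to `X ⊕ X`). -/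
def IsSquareFreeModule (A : Type*) [Ring A] (M : Type*) [AddCommGroup M]
    [Module A M] : Prop :=
  ∀ N₁ N₂ : Submodule A M, N₁ ⊓ N₂ = ⊥ → Nonempty ((N₁ : Type _) ≃ₗ[A] N₂) → N₁ = ⊥

/-- A module `M` is *square-full* if every nonzero submodule of `M` contains a
nonzero submodule `N` such that `N ⊕ N` embeds in `M`. -/
def IsSquareFullModule (A : Type*) [Ring A] (M : Type*) [AddCommGroup M]
    [Module A M] : Prop :=
  ∀ U : Submodule A M, U ≠ ⊥ → ∃ N N₁ N₂ : Submodule A M, N ≠ ⊥ ∧ N ≤ U ∧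
    N₁ ⊓ N₂ = ⊥ ∧ Nonempty ((N : Type _) ≃ₗ[A] N₁) ∧ Nonempty ((N : Type _) ≃ₗ[A] N₂)

/-- A *CS module*: every submodule is essential in a direct summand. -/
def IsCSModule (A : Type*) [Ring A] (M : Type*) [AddCommGroup M] [Module A M] : Prop :=
  ∀ N : Submodule A M, ∃ D : Submodule A M, (∃ D' : Submodule A M, IsCompl D D') ∧
    N ≤ D ∧ ∀ K : Submodule A M, K ≤ D → K ⊓ N = ⊥ → K = ⊥

/-- A *weak CS module*: every semisimple submodule is essential in a direct summand. -/
def IsWeakCSModule (A : Type*) [Ring A] (M : Type*) [AddCommGroup M] [Module A M] : Prop :=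
  ∀ N : Submodule A M, IsSemisimpleModule A N → ∃ D : Submodule A M,
    (∃ D' : Submodule A M, IsCompl D D') ∧ N ≤ D ∧
      ∀ K : Submodule A M, K ≤ D → K ⊓ N = ⊥ → K = ⊥

/-- A *uniform module*: nonzero, and any two nonzero submodules intersect
nontrivially. -/
def IsUniformModule (A : Type*) [Ring A] (M : Type*) [AddCommGroup M] [Module A M] : Prop :=
  (⊤ : Submodule A M) ≠ ⊥ ∧ ∀ N₁ N₂ : Submodule A M, N₁ ≠ ⊥ → N₂ ≠ ⊥ → N₁ ⊓ N₂ ≠ ⊥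

/-- A ring is *semiprime* if it has no nonzero nilpotent two-sided ideal. -/
def IsSemiprimeRing (R : Type*) [Ring R] : Prop :=
  ∀ I : TwoSidedIdeal R, (∃ n : ℕ, n ≠ 0 ∧
    ∀ l : List R, l.length = n → (∀ x ∈ l, x ∈ I) → l.prod = 0) → I = ⊥

/-- A ring is *prime* if the product of any two nonzero two-sided ideals is nonzero. -/
def IsPrimeRing (R : Type*) [Ring R] : Prop :=
  ∀ I J : TwoSidedIdeal R, I ≠ ⊥ → J ≠ ⊥ → ∃ x ∈ I, ∃ y ∈ J, x * y ≠ 0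

/-- A ring is *von Neumann regular* if every element `a` satisfies `a = a * b * a`
for some `b`. -/
def IsVonNeumannRegularRing (R : Type*) [Ring R] : Prop :=
  ∀ a : R, ∃ b : R, a = a * b * a

section Modules

variable {A M : Type*} [Ring A] [AddCommGroup M] [Module A M]

/-- Elementwise form of the CS property: every submodule `N` is essential in the range of an
idempotent endomorphism fixing `N`. -/
def HasEssentialProjections (A M : Type*) [Ring A] [AddCommGroup M] [Module A M] : Prop :=
  ∀ N : Submodule A M, ∃ p : M →ₗ[A] M, (∀ x, p (p x) = p x) ∧ (∀ x ∈ N, p x = x) ∧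
    ∀ x, p x = x → x ≠ 0 → ∃ r : A, r • x ∈ N ∧ r • x ≠ 0

theorem IsCSModule.hasEssentialProjections (h : IsCSModule A M) :
    HasEssentialProjections A M := by
  intro N
  obtain ⟨D, ⟨D', hD⟩, hND, hess⟩ := h N
  refine ⟨D.projection D' hD, fun x => ?_, fun x hx => ?_, fun x hx hx0 => ?_⟩
  · exact (Submodule.projection_eq_self_iff hD _).2
      (Submodule.projection_apply_mem hD x)
  · exact (Submodule.projection_eq_self_iff hD x).2 (hND hx)
  · have hxD : x ∈ D := (Submodule.projection_eq_self_iff hD x).1 hx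
    by_contra! hc
    refine hx0 (Submodule.span_singleton_eq_bot.1 (hess (A ∙ x) ?_ ?_))
    · exact (Submodule.span_singleton_le_iff_mem x D).2 hxD
    · rw [eq_bot_iff]
      rintro y ⟨hy, hyN⟩
      obtain ⟨r, rfl⟩ := Submodule.mem_span_singleton.1 hy
      exact (Submodule.mem_bot A).2 (hc r hyN)

/-- In an automorphism-invariant module, partial endomorphisms with essential kernel extend. -/
theorem IsAutomorphismInvariant.exists_extension_of_essential_ker
    (h : IsAutomorphismInvariant A M) (N : Submodule A M) (d : N →ₗ[A] M)
    (hd : ∀ x : N, x ≠ 0 → ∃ r : A, r • x ≠ 0 ∧ d (r • x) = 0) :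
    ∃ g : M →ₗ[A] M, ∀ x : N, g x = d x := by
  obtain ⟨g, hg⟩ := h N (N.subtype - d) (by
    rw [injective_iff_map_eq_zero]
    intro x hx
    by_contra hx0
    obtain ⟨r, hr, hdr⟩ := hd x hx0
    apply hr
    have hx' : (N.subtype - d) (r • x) = 0 := by rw [map_smul, hx, smul_zero]
    rw [LinearMap.sub_apply, hdr, sub_zero] at hx'
    exact Subtype.ext hx')
  refine ⟨LinearMap.id - g, fun x => ?_⟩
  rw [LinearMap.sub_apply, hg]
  simp

theorem IsAutomorphismInvariant.exists_extension_of_essential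
    (h : IsAutomorphismInvariant A M) (hcs : HasEssentialProjections A M)
    (N : Submodule A M) (hN : ∀ x : M, x ≠ 0 → ∃ r : A, r • x ∈ N ∧ r • x ≠ 0)
    (f : N →ₗ[A] M) : ∃ g : M →ₗ[A] M, ∀ x : N, g x = f x := by
  obtain ⟨p, hpp, hpN, hpe⟩ := hcs ((LinearMap.ker f).map N.subtype)
  let P : Submodule A M := N ⊓ LinearMap.eqLocus p LinearMap.id
  let Q : Submodule A M := N ⊓ LinearMap.ker p
  obtain ⟨g₁, hg₁⟩ := h.exists_extension_of_essential_ker P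
    (f ∘ₗ Submodule.inclusion inf_le_left) (by
      rintro ⟨x, hxN, hxp⟩ hx0
      obtain ⟨r, hr, hr0⟩ := hpe x hxp (fun h0 => hx0 (Subtype.ext h0))
      refine ⟨r, fun h0 => hr0 (congrArg Subtype.val h0), ?_⟩
      obtain ⟨y, hy, hyr⟩ := hr
      have : Submodule.inclusion inf_le_left (r • (⟨x, hxN, hxp⟩ : P)) = y :=
        Subtype.ext hyr.symm
      rw [LinearMap.comp_apply, this]
      exact hy)
  obtain ⟨g₂, hg₂⟩ := h Q (f ∘ₗ Submodule.inclusion inf_le_left) (by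
    rw [injective_iff_map_eq_zero]
    rintro ⟨x, hxN, hxp⟩ hx
    have hpx := hpN x ⟨⟨x, hxN⟩, hx, rfl⟩
    exact Subtype.ext (hpx.symm.trans hxp))
  have hg₁' (x : M) (hx : x ∈ N) (hp : p x = x) : g₁ x = f ⟨x, hx⟩ := hg₁ ⟨x, hx, hp⟩
  have hg₂' (x : M) (hx : x ∈ N) (hp : p x = 0) : g₂ x = f ⟨x, hx⟩ := hg₂ ⟨x, hx, hp⟩
  let g : M →ₗ[A] M := g₁ ∘ₗ p + g₂ ∘ₗ (LinearMap.id - p)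
  have hg (x : M) (hx : x ∈ N) (hpx : p x ∈ N) : g x = f ⟨x, hx⟩ := by
    have hqx : x - p x ∈ N := N.sub_mem hx hpx
    have : (⟨x, hx⟩ : N) = ⟨p x, hpx⟩ + ⟨x - p x, hqx⟩ := Subtype.ext (by simp)
    rw [this, map_add, ← hg₁' _ hpx (hpp x), ← hg₂' _ hqx (by rw [map_sub, hpp, sub_self])]
    rfl
  obtain ⟨k, hk⟩ := h.exists_extension_of_essential_ker N (f - g ∘ₗ N.subtype) (by
    rintro ⟨x, hx⟩ hx0
    by_cases hp : p x = 0
    · refine ⟨1, by rwa [one_smul], ?_⟩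
      rw [one_smul, LinearMap.sub_apply, ← hg x hx (by rw [hp]; exact N.zero_mem)]
      exact sub_self _
    · obtain ⟨r, hr, hr0⟩ := hN _ hp
      rw [← map_smul] at hr hr0
      refine ⟨r, fun h0 => hr0 ?_, ?_⟩
      · have : r • x = 0 := congrArg Subtype.val h0
        rw [this, map_zero]
      · rw [LinearMap.sub_apply, sub_eq_zero]
        exact (hg (r • x) (N.smul_mem r hx) hr).symm)
  refine ⟨k + g, fun x => ?_⟩
  rw [LinearMap.add_apply, hk]
  simp

theorem IsAutomorphismInvariant.isQuasiInjective
    (h : IsAutomorphismInvariant A M) (hcs : HasEssentialProjections A M) :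
    IsQuasiInjective A M := by
  intro N f
  obtain ⟨p, hpp, hpN, hpe⟩ := hcs N
  obtain ⟨g, hg⟩ := h.exists_extension_of_essential hcs (N.comap p) (by
    intro x hx
    by_cases hp : p x = 0
    · exact ⟨1, by simp [hp], by rwa [one_smul]⟩
    · obtain ⟨r, hr, hr0⟩ := hpe _ (hpp x) hp
      refine ⟨r, by simpa using hr, fun h0 => hr0 ?_⟩
      rw [← map_smul, h0, map_zero]) (f ∘ₗ p.restrict (p := N.comap p) (q := N) fun _ hx => hx)
  refine ⟨g, fun x => ?_⟩
  have hx : (x : M) ∈ N.comap p := by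
    rw [Submodule.mem_comap, hpN x x.2]
    exact x.2
  exact (hg ⟨x, hx⟩).trans (congrArg f (Subtype.ext (hpN x x.2)))

theorem IsQuasiInjective.of_retract {M' : Type*} [AddCommGroup M'] [Module A M']
    (h : IsQuasiInjective A M) (i : M' →ₗ[A] M) (p : M →ₗ[A] M') (hpi : ∀ x, p (i x) = x) :
    IsQuasiInjective A M' := by
  intro N f
  have hres : ∀ x ∈ N.map i, p x ∈ N := by
    rintro _ ⟨x, hx, rfl⟩
    rwa [hpi]
  obtain ⟨g, hg⟩ := h (N.map i) (i ∘ₗ f ∘ₗ p.restrict hres)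
  refine ⟨p ∘ₗ g ∘ₗ i, fun x => ?_⟩
  have hx : p (g (i x)) = p (i (f (p.restrict hres ⟨i x, x, x.2, rfl⟩))) :=
    congrArg p (hg ⟨i x, x, x.2, rfl⟩)
  rw [hpi] at hx
  exact hx.trans (congrArg f (Subtype.ext (hpi x)))

theorem exists_le_maximal_disjoint (N C : Submodule A M) (h : Disjoint N C) :
    ∃ D, C ≤ D ∧ Maximal (Disjoint N) D := by
  refine zorn_le_nonempty₀ {D | Disjoint N D} (fun c hc hchain y hy => ?_) C h
  refine ⟨sSup c, ?_, fun z hz => le_sSup hz⟩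
  exact (DirectedOn.disjoint_sSup_right hchain.directedOn).2 fun b hb => hc hb

theorem IsQuasiInjective.isCSModule (h : IsQuasiInjective A M) : IsCSModule A M := by
  intro N
  obtain ⟨C, -, hC⟩ := exists_le_maximal_disjoint N ⊥ disjoint_bot_right
  obtain ⟨D, hND, hD⟩ := exists_le_maximal_disjoint C N hC.prop.symm
  have hCD : Disjoint C D := hD.prop
  have hmem (x : M) : x ∈ C → x ∈ D → x = 0 := Submodule.disjoint_def.1 hCD x
  have hCmax (K : Submodule A M) (hCK : C ≤ K) (hK : ∀ x ∈ N, x ∈ K → x = 0) : K ≤ C :=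
    hC.le_of_ge (Submodule.disjoint_def.2 hK) hCK
  obtain ⟨g, hgD, hgC⟩ : ∃ g : M →ₗ[A] M, (∀ x ∈ D, g x = x) ∧ ∀ x ∈ C, g x = 0 := by
    let φ := Submodule.mkQ C
    have hinj : Function.Injective (φ ∘ₗ D.subtype) := by
      rw [injective_iff_map_eq_zero]
      intro x hx
      exact Subtype.ext (hmem x ((Submodule.Quotient.mk_eq_zero C).1 hx) x.2)
    let e := LinearEquiv.ofInjective _ hinj
    have hres : ∀ x ∈ C ⊔ D, φ x ∈ LinearMap.range (φ ∘ₗ D.subtype) := by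
      intro x hx
      obtain ⟨c, hc, d, hd, rfl⟩ := Submodule.mem_sup.1 hx
      refine ⟨⟨d, hd⟩, ?_⟩
      have : φ c = 0 := (Submodule.Quotient.mk_eq_zero C).2 hc
      rw [map_add, this, zero_add]
      rfl
    obtain ⟨g, hg⟩ := h (C ⊔ D) (D.subtype ∘ₗ e.symm.toLinearMap ∘ₗ φ.restrict hres)
    refine ⟨g, fun x hx => ?_, fun x hx => ?_⟩
    · refine (hg ⟨x, Submodule.mem_sup_right hx⟩).trans ?_
      have : φ.restrict hres ⟨x, Submodule.mem_sup_right hx⟩ = e ⟨x, hx⟩ := Subtype.ext rfl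
      simp [this]
    · refine (hg ⟨x, Submodule.mem_sup_left hx⟩).trans ?_
      have : φ.restrict hres ⟨x, Submodule.mem_sup_left hx⟩ = 0 :=
        Subtype.ext ((Submodule.Quotient.mk_eq_zero C).2 hx)
      simp [this]
  have hker : LinearMap.ker g ≤ C := hCmax _ hgC fun x hx hgx => by
    rw [← hgD x (hND hx)]
    exact hgx
  have hpre : (C.comap g) ≤ C := hCmax _
    (fun x hx => by rw [Submodule.mem_comap, hgC x hx]; exact C.zero_mem)
    (fun x hx hgx => by
      rw [Submodule.mem_comap, hgD x (hND hx)] at hgx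
      exact hmem x hgx (hND hx))
  have hrange : LinearMap.range g ≤ D := by
    refine hD.le_of_ge (Submodule.disjoint_def.2 ?_) fun x hx => ⟨x, hgD x hx⟩
    rintro _ hy ⟨x, rfl⟩
    exact hgC x (hpre hy)
  refine ⟨D, ⟨C, hCD.symm, ?_⟩, hND, fun K hKD hKN => ?_⟩
  · rw [codisjoint_iff, eq_top_iff]
    intro x _
    refine Submodule.mem_sup.2 ⟨g x, hrange ⟨x, rfl⟩, x - g x, hker ?_, by abel⟩
    rw [LinearMap.mem_ker, map_sub, hgD _ (hrange ⟨x, rfl⟩), sub_self]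
  · have hK : C ⊔ K ≤ C := hCmax _ le_sup_left (by
      rintro x hx hxCK
      obtain ⟨c, hc, k, hk, rfl⟩ := Submodule.mem_sup.1 hxCK
      have hcD : c ∈ D := by
        have := D.sub_mem (hND hx) (hKD hk)
        rwa [add_sub_cancel_right] at this
      obtain rfl := hmem c hc hcD
      rw [zero_add] at hx ⊢
      exact (Submodule.mem_bot A).1 (hKN ▸ Submodule.mem_inf.2 ⟨hk, hx⟩))
    rw [eq_bot_iff]
    intro x hx
    exact (Submodule.mem_bot A).2 (hmem x (hK (Submodule.mem_sup_right hx)) (hKD hx))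

end Modules

section RightIdeals

variable {R : Type*} [Ring R]

theorem Submodule.mul_mem_right {I : Submodule Rᵐᵒᵖ R} {x : R} (hx : x ∈ I) (r : R) :
    x * r ∈ I :=
  I.smul_mem (MulOpposite.op r) hx

/-- Left multiplication by `a`, as an endomorphism of the right module `R`. -/
def leftMul (a : R) : R →ₗ[Rᵐᵒᵖ] R where
  toFun x := a * x
  map_add' := mul_add a
  map_smul' r x := by simp [MulOpposite.smul_eq_mul_unop, mul_assoc]

theorem linearMap_apply_eq_mul (p : R →ₗ[Rᵐᵒᵖ] R) (x : R) : p x = p 1 * x := by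
  have := p.map_smul (MulOpposite.op x) 1
  simpa [MulOpposite.smul_eq_mul_unop] using this

/-- An automorphism-invariant essential right ideal is stable under left multiplication by left
regular elements. -/
theorem IsAutomorphismInvariant.mul_mem {I : Submodule Rᵐᵒᵖ R}
    (h : IsAutomorphismInvariant Rᵐᵒᵖ I)
    (hI : ∀ x : R, x ≠ 0 → ∃ r, x * r ∈ I ∧ x * r ≠ 0) {u : R}
    (hu : ∀ x, u * x = 0 → x = 0) {x : R} (hx : x ∈ I) : u * x ∈ I := by
  let N : Submodule Rᵐᵒᵖ I := I.comap (leftMul u ∘ₗ I.subtype)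
  obtain ⟨g, hg⟩ := h N ((leftMul u ∘ₗ I.subtype).restrict (p := N) (q := I) fun _ hy => hy) (by
    rw [injective_iff_map_eq_zero]
    intro y hy
    exact Subtype.ext (Subtype.ext (hu _ (congrArg Subtype.val hy))))
  have hgN (y : I) (hy : u * (y : R) ∈ I) : (g y : R) = u * y :=
    congrArg Subtype.val (hg ⟨y, hy⟩)
  have hgx : (g ⟨x, hx⟩ : R) = u * x := by
    by_contra hne
    obtain ⟨r, hr, hr0⟩ := hI _ (sub_ne_zero.2 hne)
    have hxr : x * r ∈ I := Submodule.mul_mem_right hx r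
    have hgr : (g ⟨x * r, hxr⟩ : R) = g ⟨x, hx⟩ * r :=
      congrArg Subtype.val (g.map_smul (MulOpposite.op r) ⟨x, hx⟩)
    have hgrI : (g ⟨x, hx⟩ : R) * r ∈ I := Submodule.mul_mem_right (g ⟨x, hx⟩).2 r
    have hmem : u * (x * r) ∈ I := by
      have := I.sub_mem hgrI hr
      rwa [sub_mul, sub_sub_cancel, mul_assoc] at this
    apply hr0
    rw [sub_mul, ← hgr, hgN _ hmem, mul_assoc, sub_self]
  rw [← hgx]
  exact (g ⟨x, hx⟩).2

/-- Over a right `a`-ring, `e R (1 - e)` lies in every essential right ideal. -/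
theorem IsRightARing.mem_of_essential (h : IsRightARing R) {I : Submodule Rᵐᵒᵖ R}
    (hI : ∀ x : R, x ≠ 0 → ∃ r, x * r ∈ I ∧ x * r ≠ 0) {e : R} (he : e * e = e) {a : R}
    (hea : e * a = a) (hae : a * e = 0) : a ∈ I := by
  let I' : Submodule Rᵐᵒᵖ R := I.comap (leftMul e)
  have hI' : ∀ x : R, x ≠ 0 → ∃ r, x * r ∈ I' ∧ x * r ≠ 0 := by
    intro x hx
    by_cases hex : e * x = 0
    · refine ⟨1, ?_, by rwa [mul_one]⟩
      change e * (x * 1) ∈ I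
      rw [mul_one, hex]
      exact I.zero_mem
    · obtain ⟨r, hr, hr0⟩ := hI _ hex
      rw [mul_assoc] at hr hr0
      exact ⟨r, hr, fun h0 => hr0 (by rw [h0, mul_zero])⟩
  have haa : a * a = 0 := by
    rw [← hea, ← mul_assoc, mul_assoc e a e, hae, mul_zero, zero_mul]
  have h1 : (1 - e) ∈ I' := by
    change e * (1 - e) ∈ I
    rw [mul_sub, mul_one, he, sub_self]
    exact I.zero_mem
  have h2 : (1 + a) * (1 - e) ∈ I' := (h I').mul_mem hI' (fun x hx => by
    have h3 : (1 - a) * ((1 + a) * x) = x := by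
      rw [← mul_assoc]
      have : (1 - a) * (1 + a) = 1 := by
        rw [sub_mul, one_mul, mul_add, mul_one, haa]
        abel
      rw [this, one_mul]
    rw [← h3, hx, mul_zero]) h1
  have h3 := I'.sub_mem h2 h1
  have h4 : (1 + a) * (1 - e) - (1 - e) = a := by
    rw [add_mul, one_mul, add_sub_cancel_left, mul_sub, mul_one, hae, sub_zero]
  rw [h4] at h3
  change e * a ∈ I at h3
  rwa [hea] at h3

/-- Over a right `a`-ring, essential right ideals are stable under left multiplication by
idempotents. -/
theorem IsRightARing.idempotent_mul_mem (h : IsRightARing R) {I : Submodule Rᵐᵒᵖ R}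
    (hI : ∀ x : R, x ≠ 0 → ∃ r, x * r ∈ I ∧ x * r ≠ 0) {e : R} (he : e * e = e) {x : R}
    (hx : x ∈ I) : e * x ∈ I := by
  have h1 : e * x * (1 - e) ∈ I := h.mem_of_essential hI he
    (by rw [← mul_assoc, ← mul_assoc, he]) (by rw [mul_assoc, sub_mul, he]; simp)
  have hf : (1 - e) * (1 - e) = 1 - e := by
    exact IsIdempotentElem.one_sub he
  have h2 : (1 - e) * x * e ∈ I := h.mem_of_essential hI hf
    (by rw [← mul_assoc, ← mul_assoc, hf])
    (by rw [mul_assoc, mul_sub, mul_one, he, sub_self, mul_zero])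
  have h3 : x * e ∈ I := Submodule.mul_mem_right hx e
  have h4 : e * x = e * x * (1 - e) + (x * e - (1 - e) * x * e) := by noncomm_ring
  rw [h4]
  exact I.add_mem h1 (I.sub_mem h3 h2)

theorem IsRightARing.isQuasiInjective_of_essential (h : IsRightARing R)
    (hcs : HasEssentialProjections Rᵐᵒᵖ R) {I : Submodule Rᵐᵒᵖ R}
    (hI : ∀ x : R, x ≠ 0 → ∃ r, x * r ∈ I ∧ x * r ≠ 0) : IsQuasiInjective Rᵐᵒᵖ I := by
  refine (h I).isQuasiInjective fun N => ?_
  obtain ⟨p, hpp, hpN, hpe⟩ := hcs (N.map I.subtype)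
  have hpI : ∀ x ∈ I, p x ∈ I := by
    intro x hx
    rw [linearMap_apply_eq_mul]
    exact h.idempotent_mul_mem hI (by rw [← linearMap_apply_eq_mul, hpp]) hx
  refine ⟨p.restrict hpI, fun x => Subtype.ext (hpp x),
    fun x hx => Subtype.ext (hpN x ⟨x, hx, rfl⟩), fun x hx hx0 => ?_⟩
  obtain ⟨r, ⟨y, hy, hyr⟩, hr0⟩ :=
    hpe x (congrArg Subtype.val hx) (fun h0 => hx0 (Subtype.ext h0))
  have hyx : y = r • x := Subtype.ext hyr
  exact ⟨r, hyx ▸ hy, fun h0 => hr0 (congrArg Subtype.val h0)⟩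

theorem IsRightARing.isRightQRing (h : IsRightARing R)
    (hcs : HasEssentialProjections Rᵐᵒᵖ R) : IsRightQRing R := by
  intro I
  obtain ⟨p, hpp, hpI, hpe⟩ := hcs I
  have hess : ∀ x : R, x ≠ 0 → ∃ r, x * r ∈ I.comap p ∧ x * r ≠ 0 := by
    intro x hx
    by_cases hp : p x = 0
    · exact ⟨1, by simp [hp], by rwa [mul_one]⟩
    · obtain ⟨r, hr, hr0⟩ := hpe _ (hpp x) hp
      rw [← map_smul] at hr hr0
      exact ⟨r.unop, hr, fun h0 => hr0 ((congrArg p h0).trans (map_zero p))⟩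
  have hle : I ≤ I.comap p := fun x hx => by
    rw [Submodule.mem_comap, hpI x hx]
    exact hx
  exact (h.isQuasiInjective_of_essential hcs hess).of_retract (Submodule.inclusion hle)
    (p.restrict (p := I.comap p) (q := I) fun _ hx => hx)
    fun x => Subtype.ext (hpI x x.2)

theorem IsRightQRing.isCSModule (h : IsRightQRing R) : IsCSModule Rᵐᵒᵖ R :=
  ((h ⊤).of_retract (Submodule.topEquiv (R := Rᵐᵒᵖ) (M := R)).symm.toLinearMap
    (Submodule.topEquiv (R := Rᵐᵒᵖ) (M := R)).toLinearMap fun x => by simp).isCSModule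

theorem IsRightQRing.isRightARing (h : IsRightQRing R) : IsRightARing R :=
  fun I N f _ => h I N f

end RightIdeals

/-- an indecomposable non-local ring is a right `q`-ring iff it is a
right CS ring and a right `a`-ring. -/
theorem indecomposable_nonlocal_qRing_iff (R : Type*) [Ring R]
    (hind : ∀ e : R, IsIdempotentElem e → e ∈ Set.center R → e = 0 ∨ e = 1)
    (hnl : ¬ ∃! I : Submodule Rᵐᵒᵖ R, IsCoatom I) :
    IsRightQRing R ↔ (IsCSModule Rᵐᵒᵖ R ∧ IsRightARing R) :=
  ⟨fun h => ⟨h.isCSModule, h.isRightARing⟩, fun h => h.2.isRightQRing h.1.hasEssentialProjections⟩
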